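/- arXiv:1606.05398 — 9 statements merged into one kernel-verified Lean document; each statement's English description precedes it below -/
import Mathlib

section
/- A sequence T : ℕ → ℝ satisfies the product rule for triangular numbers if and only if it is one of the following five sequences: (1) T(n) = 0 for all n ≥ 0; (2) T(n) = 1/2 for all n ≥ 0; (3) T(0) = 0 and T(2n) = T(2n−1) = n for all n ≥ 1; (4) T(3n) = T(3n+2) = 0 and T(3n+1) = 1 for all n ≥ 0; (5) T(n) = n(n+1)/2 for all n ≥ 0. -/
def ProductRule (T : ℕ → ℝ) : Prop :=
  ∀ m n : ℕ, 1 ≤ m → 1 ≤ n → T (m * n) = T m * T n + T (m - 1) * T (n - 1)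

namespace ProductRule

variable {S T : ℕ → ℝ}

lemma eq_half_of_apply_zero_ne_zero (h : ProductRule T) (h0 : T 0 ≠ 0) (n : ℕ) : T n = 1 / 2 := by
  have h11 : T 1 = T 1 * T 1 + T 0 * T 0 := h 1 1 le_rfl le_rfl
  have hone (n : ℕ) : T (n + 1) = T (n + 1) * T 1 + T n * T 0 := by
    simpa using h (n + 1) 1 (by omega) le_rfl
  have h22 : T 4 = T 2 * T 2 + T 1 * T 1 := h 2 2 (by norm_num) (by norm_num)
  have h1 : 1 - T 1 ≠ 0 := by
    intro h1
    have : T 1 = 1 := by linarith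
    rw [this] at h11
    exact h0 (by nlinarith)
  obtain ⟨r, hr⟩ : ∃ r, T 0 = r * (1 - T 1) := ⟨T 0 / (1 - T 1), by field_simp⟩
  have hstep (n : ℕ) : T (n + 1) = r * T n :=
    mul_right_cancel₀ h1 (by rw [mul_right_comm, ← hr]; linear_combination hone n)
  have e1 := hstep 0
  have e2 := hstep 1
  have e3 := hstep 2
  have e4 := hstep 3
  norm_num at e1 e2 e3 e4
  have hr0 : r ≠ 0 := by
    rintro rfl
    simp at hr
    exact h0 hr
  have ha : r = T 0 * (r ^ 2 + 1) := by
    apply mul_left_cancel₀ h0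
    rw [e1] at h11
    linear_combination h11
  have hb : r ^ 2 = T 0 * (r ^ 2 + 1) := by
    apply mul_left_cancel₀ (mul_ne_zero h0 (pow_ne_zero 2 hr0))
    rw [e4, e3, e2, e1] at h22
    linear_combination h22
  have hr1 : r = 1 := mul_left_cancel₀ hr0 (by linear_combination hb - ha)
  subst hr1
  induction n with
  | zero => linarith
  | succ n ih => rw [hstep, ih, one_mul]

lemma apply_four_mul (h : ProductRule T) (h1 : T 1 = 1) {k : ℕ} (hk : 1 ≤ k) :
    T (4 * k) = (T 2 ^ 2 + 1) * T k + T 3 * T (k - 1) := by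
  have h22 : T 4 = T 2 * T 2 + T 1 * T 1 := h 2 2 (by norm_num) (by norm_num)
  have h4 : T (4 * k) = T 4 * T k + T 3 * T (k - 1) := h 4 k (by norm_num) hk
  rw [h4, h22, h1]
  ring

lemma apply_two_mul (h : ProductRule T) (h1 : T 1 = 1) {k : ℕ} (hk : 1 ≤ k) :
    T (2 * k) = T 2 * T k + T (k - 1) := by
  simpa [h1] using h 2 k (by norm_num) hk

lemma apply_two_mul_sub_one (h : ProductRule T) (h1 : T 1 = 1) {k : ℕ} (hk : 1 ≤ k) :
    T (2 * k - 1) = T k + (T 3 - T 2) * T (k - 1) := by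
  have h2 : T (2 * (2 * k)) = T 2 * T (2 * k) + T (2 * k - 1) :=
    h.apply_two_mul h1 (by omega)
  have h4 := h.apply_four_mul h1 hk
  rw [h.apply_two_mul h1 hk, show 2 * (2 * k) = 4 * k by ring, h4] at h2
  linear_combination -h2

lemma eq_of_eq_two_of_eq_three (hT : ProductRule T) (hS : ProductRule S) (h0 : T 0 = S 0)
    (hT1 : T 1 = 1) (hS1 : S 1 = 1) (h2 : T 2 = S 2) (h3 : T 3 = S 3) (n : ℕ) : T n = S n := by
  induction n using Nat.strong_induction_on with
  | _ n ih =>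
    obtain rfl | rfl | hn : n = 0 ∨ n = 1 ∨ 2 ≤ n := by omega
    · exact h0
    · rw [hT1, hS1]
    · obtain ⟨k, hk, rfl | rfl⟩ : ∃ k, 1 ≤ k ∧ (n = 2 * k ∨ n = 2 * k - 1) :=
        ⟨(n + 1) / 2, by omega, by omega⟩
      · rw [hT.apply_two_mul hT1 hk, hS.apply_two_mul hS1 hk, h2, ih k (by omega),
          ih (k - 1) (by omega)]
      · rw [hT.apply_two_mul_sub_one hT1 hk, hS.apply_two_mul_sub_one hS1 hk, h2, h3,
          ih k (by omega), ih (k - 1) (by omega)]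

lemma apply_two_and_apply_three (h : ProductRule T) (h1 : T 1 = 1) :
    (T 2 = 1 ∧ T 3 = 2) ∨ (T 2 = 0 ∧ T 3 = 0) ∨ (T 2 = 3 ∧ T 3 = 6) := by
  have e4 : T 4 = T 2 * T 2 + T 1 := h.apply_two_mul h1 (k := 2) (by norm_num)
  have e5 : T 5 = T 3 + (T 3 - T 2) * T 2 := h.apply_two_mul_sub_one h1 (k := 3) (by norm_num)
  have e6 : T 6 = T 2 * T 3 + T 2 := h.apply_two_mul h1 (k := 3) (by norm_num)
  have e7 : T 7 = T 4 + (T 3 - T 2) * T 3 := h.apply_two_mul_sub_one h1 (k := 4) (by norm_num)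
  have e8 : T 8 = T 2 * T 4 + T 3 := h.apply_two_mul h1 (k := 4) (by norm_num)
  have e9 : T 9 = T 5 + (T 3 - T 2) * T 4 := h.apply_two_mul_sub_one h1 (k := 5) (by norm_num)
  have e15 : T 15 = T 8 + (T 3 - T 2) * T 7 :=
    h.apply_two_mul_sub_one h1 (k := 8) (by norm_num)
  have e18 : T 18 = T 2 * T 9 + T 8 := h.apply_two_mul h1 (k := 9) (by norm_num)
  have p9 : T 9 = T 3 * T 3 + T 2 * T 2 := h 3 3 (by norm_num) (by norm_num)
  have p15 : T 15 = T 3 * T 5 + T 2 * T 4 := h 3 5 (by norm_num) (by norm_num)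
  have p18 : T 18 = T 3 * T 6 + T 2 * T 5 := h 3 6 (by norm_num) (by norm_num)
  generalize T 2 = a at *
  generalize T 3 = b at *
  have q9 : b ^ 2 - (2 + a + a ^ 2) * b + a ^ 3 + 2 * a ^ 2 + a = 0 := by grind
  have q18 : 3 * a ^ 3 + a = b * (a ^ 2 + 2 * a - 1) := by grind
  have q15 : b ^ 3 - (1 + 3 * a) * b ^ 2 + (3 * a ^ 2 + 2) * b - a ^ 3 - a = 0 := by grind
  clear * - q9 q18 q15
  have ha : a * (a - 1) * (a - 3) = 0 := by grind
  have hb : (b - 2) * b * (b - 6) = 0 := by grind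
  grind

lemma const_zero : ProductRule fun _ ↦ 0 := by
  intro m n _ _
  norm_num

lemma const_half : ProductRule fun _ ↦ 1 / 2 := by
  intro m n _ _
  norm_num

lemma half_ceil : ProductRule fun n ↦ ((n + 1) / 2 : ℕ) := by
  intro m n hm hn
  obtain ⟨k, rfl | rfl⟩ : ∃ k, m = 2 * k + 2 ∨ m = 2 * k + 1 := ⟨(m - 1) / 2, by omega⟩ <;>
    obtain ⟨l, rfl | rfl⟩ : ∃ l, n = 2 * l + 2 ∨ n = 2 * l + 1 := ⟨(n - 1) / 2, by omega⟩
  all_goals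
    beta_reduce
    norm_cast
  · rw [show ((2 * k + 2) * (2 * l + 2) + 1) / 2 = 2 * (k + 1) * (l + 1) by
        rw [show (2 * k + 2) * (2 * l + 2) + 1 = 1 + 2 * (2 * (k + 1) * (l + 1)) by ring]; omega,
      show (2 * k + 2 + 1) / 2 = k + 1 by omega, show (2 * l + 2 + 1) / 2 = l + 1 by omega,
      show (2 * k + 2 - 1 + 1) / 2 = k + 1 by omega,
      show (2 * l + 2 - 1 + 1) / 2 = l + 1 by omega]
    ring
  · rw [show ((2 * k + 2) * (2 * l + 1) + 1) / 2 = (k + 1) * (2 * l + 1) by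
        rw [show (2 * k + 2) * (2 * l + 1) + 1 = 1 + 2 * ((k + 1) * (2 * l + 1)) by ring]; omega,
      show (2 * k + 2 + 1) / 2 = k + 1 by omega, show (2 * l + 1 + 1) / 2 = l + 1 by omega,
      show (2 * k + 2 - 1 + 1) / 2 = k + 1 by omega,
      show (2 * l + 1 - 1 + 1) / 2 = l by omega]
    ring
  · rw [show ((2 * k + 1) * (2 * l + 2) + 1) / 2 = (2 * k + 1) * (l + 1) by
        rw [show (2 * k + 1) * (2 * l + 2) + 1 = 1 + 2 * ((2 * k + 1) * (l + 1)) by ring]; omega,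
      show (2 * k + 1 + 1) / 2 = k + 1 by omega, show (2 * l + 2 + 1) / 2 = l + 1 by omega,
      show (2 * k + 1 - 1 + 1) / 2 = k by omega,
      show (2 * l + 2 - 1 + 1) / 2 = l + 1 by omega]
    ring
  · rw [show ((2 * k + 1) * (2 * l + 1) + 1) / 2 = 2 * k * l + k + l + 1 by
        rw [show (2 * k + 1) * (2 * l + 1) + 1 = 2 * (2 * k * l + k + l + 1) by ring]; omega,
      show (2 * k + 1 + 1) / 2 = k + 1 by omega, show (2 * l + 1 + 1) / 2 = l + 1 by omega,
      show (2 * k + 1 - 1 + 1) / 2 = k by omega,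
      show (2 * l + 1 - 1 + 1) / 2 = l by omega]
    ring

lemma indicator_mod_three : ProductRule fun n ↦ if n % 3 = 1 then 1 else 0 := by
  intro m n hm hn
  have hm' : (m - 1) % 3 = 1 ↔ m % 3 = 2 := by omega
  have hn' : (n - 1) % 3 = 1 ↔ n % 3 = 2 := by omega
  have hm3 : m % 3 < 3 := Nat.mod_lt _ (by norm_num)
  have hn3 : n % 3 < 3 := Nat.mod_lt _ (by norm_num)
  simp only [Nat.mul_mod m n, hm', hn']
  interval_cases m % 3 <;> interval_cases n % 3 <;> norm_num

lemma triangular : ProductRule fun n ↦ n * (n + 1) / 2 := by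
  intro m n hm hn
  simp only [Nat.cast_mul, Nat.cast_sub hm, Nat.cast_sub hn, Nat.cast_one]
  ring

end ProductRule

theorem stmt_0 (T : ℕ → ℝ) :
    ProductRule T ↔
      ((∀ n : ℕ, T n = 0) ∨
       (∀ n : ℕ, T n = 1 / 2) ∨
       (T 0 = 0 ∧ ∀ n : ℕ, 1 ≤ n → T (2 * n) = n ∧ T (2 * n - 1) = n) ∨
       (∀ n : ℕ, T (3 * n) = 0 ∧ T (3 * n + 1) = 1 ∧ T (3 * n + 2) = 0) ∨
       (∀ n : ℕ, T n = n * (n + 1) / 2)) := by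
  constructor
  · intro h
    by_cases h0 : T 0 = 0
    swap
    · exact Or.inr (Or.inl (h.eq_half_of_apply_zero_ne_zero h0))
    by_cases h1 : T 1 = 1
    swap
    · left
      intro n
      obtain rfl | hn := Nat.eq_zero_or_pos n
      · exact h0
      · have hn1 : T n = T n * T 1 := by simpa [h0] using h n 1 hn le_rfl
        exact (mul_eq_zero.mp (show T n * (T 1 - 1) = 0 by linear_combination -hn1)).resolve_right
          (sub_ne_zero.mpr h1)
    right; right
    obtain ⟨h2, h3⟩ | ⟨h2, h3⟩ | ⟨h2, h3⟩ := h.apply_two_and_apply_three h1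
    · left
      have hT := h.eq_of_eq_two_of_eq_three ProductRule.half_ceil (by simp [h0]) h1
        (by norm_num) (by norm_num [h2]) (by norm_num [h3])
      refine ⟨h0, fun n hn ↦ ?_⟩
      rw [hT, hT, show (2 * n + 1) / 2 = n by omega, show (2 * n - 1 + 1) / 2 = n by omega]
      exact ⟨rfl, rfl⟩
    · right; left
      have hT := h.eq_of_eq_two_of_eq_three ProductRule.indicator_mod_three (by simp [h0]) h1
        (by norm_num) (by norm_num [h2]) (by norm_num [h3])
      intro n
      simp [hT, Nat.add_mod]
    · right; right
      exact h.eq_of_eq_two_of_eq_three ProductRule.triangular (by simp [h0]) h1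
        (by norm_num) (by norm_num [h2]) (by norm_num [h3])
  · rintro (h | h | ⟨h0, h⟩ | h | h)
    · rw [funext h]
      exact ProductRule.const_zero
    · rw [funext h]
      exact ProductRule.const_half
    · convert ProductRule.half_ceil with n
      obtain rfl | ⟨k, hk, rfl | rfl⟩ : n = 0 ∨ ∃ k, 1 ≤ k ∧ (n = 2 * k ∨ n = 2 * k - 1) :=
        or_iff_not_imp_left.mpr fun hn ↦ ⟨(n + 1) / 2, by omega, by omega⟩
      · simp [h0]
      · rw [(h k hk).1, show (2 * k + 1) / 2 = k by omega]
      · rw [(h k hk).2, show (2 * k - 1 + 1) / 2 = k by omega]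
    · convert ProductRule.indicator_mod_three with n
      obtain ⟨k, rfl | rfl | rfl⟩ : ∃ k, n = 3 * k ∨ n = 3 * k + 1 ∨ n = 3 * k + 2 :=
        ⟨n / 3, by omega⟩
      · simp [(h k).1]
      · simp [(h k).2.1, Nat.add_mod]
      · simp [(h k).2.2, Nat.add_mod]
    · rw [funext h]
      exact ProductRule.triangular
end

section
/- The sequence T : ℕ → ℝ defined by T(0) = 0 and T(2n) = T(2n−1) = n for all n ≥ 1 (equivalently, T(n) = ⌈n/2⌉) satisfies the product rule for triangular numbers. -/
theorem stmt_3 (T : ℕ → ℝ) (h0 : T 0 = 0)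
    (h : ∀ n : ℕ, 1 ≤ n → T (2 * n) = n ∧ T (2 * n - 1) = n) :
    ProductRule T := by
  have even (k : ℕ) : T (2 * k) = k := by
    rcases Nat.eq_zero_or_pos k with rfl | hk
    · simpa using h0
    · exact (h k hk).1
  have odd (k : ℕ) : T (2 * k + 1) = k + 1 := by
    simpa [Nat.mul_add] using (h (k + 1) k.succ_pos).2
  have pred_even (k : ℕ) (hk : 1 ≤ 2 * k) : T (2 * k - 1) = k := (h k (by lia)).2
  intro m n hm hn
  obtain ⟨a, rfl | rfl⟩ := m.even_or_odd' <;> obtain ⟨b, rfl | rfl⟩ := n.even_or_odd'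
  · rw [show 2 * a * (2 * b) = 2 * (2 * a * b) by ring, even, even, even,
      pred_even a hm, pred_even b hn]
    push_cast
    ring
  · rw [show 2 * a * (2 * b + 1) = 2 * (a * (2 * b + 1)) by ring, even, even, odd,
      pred_even a hm, Nat.add_sub_cancel, even]
    push_cast
    ring
  · rw [show (2 * a + 1) * (2 * b) = 2 * ((2 * a + 1) * b) by ring, even, even, odd,
      pred_even b hn, Nat.add_sub_cancel, even]
    push_cast
    ring
  · rw [show (2 * a + 1) * (2 * b + 1) = 2 * (2 * a * b + a + b) + 1 by ring, odd, odd, odd,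
      Nat.add_sub_cancel, Nat.add_sub_cancel, even, even]
    push_cast
    ring
end

section
/- The sequence T : ℕ → ℝ defined by T(3n) = 0, T(3n+1) = 1, and T(3n+2) = 0 for all n ≥ 0 (i.e., T(n) = 1 if n ≡ 1 (mod 3) and T(n) = 0 otherwise) satisfies the product rule for triangular numbers. -/
theorem stmt_4 (T : ℕ → ℝ)
    (h : ∀ n : ℕ, T (3 * n) = 0 ∧ T (3 * n + 1) = 1 ∧ T (3 * n + 2) = 0) :
    ProductRule T := by
  have hT : ∀ n, T n = if n % 3 = 1 then 1 else 0 := by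
    intro n
    obtain ⟨h0, h1, h2⟩ := h (n / 3)
    have hn := Nat.div_add_mod n 3
    have hlt := Nat.mod_lt n (show 3 > 0 by norm_num)
    generalize n % 3 = r at hn hlt ⊢
    rw [← hn]
    interval_cases r <;> simp [h0, h1, h2]
  intro m n hm hn
  obtain ⟨a, rfl⟩ := Nat.exists_eq_add_of_le' hm
  obtain ⟨b, rfl⟩ := Nat.exists_eq_add_of_le' hn
  simp only [hT, Nat.add_sub_cancel]
  rw [Nat.mul_mod, Nat.add_mod a, Nat.add_mod b]
  have ha := Nat.mod_lt a (show 3 > 0 by norm_num)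
  have hb := Nat.mod_lt b (show 3 > 0 by norm_num)
  generalize a % 3 = r at ha ⊢
  generalize b % 3 = s at hb ⊢
  interval_cases r <;> interval_cases s <;> norm_num
end

section
/- If a sequence T : ℕ → ℝ satisfies the product rule for triangular numbers and T(0) ≠ 0, then T(n) = 1/2 for all n ≥ 0. -/
/-- Taking `n = 1` in the product rule shows that `T` is a geometric sequence. -/
theorem ProductRule.exists_geometric {T : ℕ → ℝ} (h : ProductRule T) (h0 : T 0 ≠ 0) :
    ∃ r : ℝ, ∀ n, T n = T 0 * r ^ n := by
  have hstep (n : ℕ) : T (n + 1) = T (n + 1) * T 1 + T n * T 0 := by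
    simpa using h (n + 1) 1 (by omega) le_rfl
  have h1 : 1 - T 1 ≠ 0 := by
    intro h1
    have hT1 : T 1 = 1 := by linarith
    have := hstep 0
    simp [hT1, h0] at this
  refine ⟨T 0 / (1 - T 1), fun n => ?_⟩
  induction n with
  | zero => simp
  | succ n ih =>
    rw [pow_succ, ← mul_assoc, ← ih, mul_div_assoc', eq_div_iff h1]
    linear_combination hstep n

theorem stmt_9 (T : ℕ → ℝ) (h : ProductRule T) (h0 : T 0 ≠ 0) :
    ∀ n : ℕ, T n = 1 / 2 := by
  obtain ⟨r, hr⟩ := h.exists_geometric h0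
  have h11 : T 1 = T 1 * T 1 + T 0 * T 0 := h 1 1 le_rfl le_rfl
  have h22 : T 4 = T 2 * T 2 + T 1 * T 1 := h 2 2 (by omega) (by omega)
  rw [hr 1] at h11
  rw [hr 4, hr 2, hr 1] at h22
  have hr_eq : r = T 0 * (r ^ 2 + 1) := by
    apply mul_left_cancel₀ h0
    linear_combination h11
  have hr0 : r ≠ 0 := by
    rintro rfl
    exact h0 (by simpa using hr_eq.symm)
  have hr1 : r = 1 := by
    apply mul_left_cancel₀ (mul_ne_zero h0 (pow_ne_zero 3 hr0))
    linear_combination h22 - T 0 * r ^ 2 * hr_eq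
  intro n
  rw [hr n, hr1, one_pow, mul_one]
  rw [hr1] at hr_eq
  linarith
end

section
/- If a sequence T : ℕ → ℝ satisfies the product rule for triangular numbers with T(0) = 0 and T(1) = 1, and we set c = T(2) and d = T(3), then T(2n) = c·T(n) + T(n−1) for all n ≥ 1 and T(2n−1) = T(n) + (d − c)·T(n−1) for all n ≥ 2. -/
theorem stmt_10 (T : ℕ → ℝ) (h : ProductRule T) (h0 : T 0 = 0) (h1 : T 1 = 1)
    (c d : ℝ) (hc : c = T 2) (hd : d = T 3) :
    (∀ n : ℕ, 1 ≤ n → T (2 * n) = c * T n + T (n - 1)) ∧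
    (∀ n : ℕ, 2 ≤ n → T (2 * n - 1) = T n + (d - c) * T (n - 1)) := by
  have double : ∀ n : ℕ, 1 ≤ n → T (2 * n) = c * T n + T (n - 1) := by
    intro n hn
    simpa [h1, ← hc] using h 2 n (by norm_num) hn
  refine ⟨double, fun n hn => ?_⟩
  have h4 : T 4 = c * c + 1 := by
    simpa [h1, ← hc] using double 2 (by norm_num)
  have h4n : T (4 * n) = T 4 * T n + d * T (n - 1) := by
    simpa [← hd] using h 4 n (by norm_num) (by lia)
  have h22n := double (2 * n) (by lia)
  rw [show 2 * (2 * n) = 4 * n by ring, h4n, h4, double n (by lia)] at h22n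
  linear_combination -h22n
end

section
/- If S and T are sequences ℕ → ℝ that both satisfy the product rule for triangular numbers, with S(0) = T(0) = 0, S(1) = T(1) = 1, S(2) = T(2), and S(3) = T(3), then S(n) = T(n) for all n ≥ 0. -/
theorem ProductRule.two_mul {T : ℕ → ℝ} (h : ProductRule T) (h1 : T 1 = 1) (k : ℕ) :
    T (2 * (k + 1)) = T 2 * T (k + 1) + T k := by
  simpa [h1] using h 2 (k + 1) (by norm_num) (by omega)

/-- Comparing the expansions of `T (4 * (k + 1))` as `4 * (k + 1)` and as `2 * (2 * (k + 1))`. -/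
theorem ProductRule.two_mul_add_one {T : ℕ → ℝ} (h : ProductRule T) (h1 : T 1 = 1) (k : ℕ) :
    T (2 * k + 1) = (T 4 - T 2 ^ 2) * T (k + 1) + (T 3 - T 2) * T k := by
  have e := h.two_mul h1 k
  have e₂ := h.two_mul h1 (2 * k + 1)
  have e₄ : T (4 * (k + 1)) = T 4 * T (k + 1) + T 3 * T k :=
    h 4 (k + 1) (by norm_num) (by omega)
  rw [show 2 * (2 * k + 1 + 1) = 4 * (k + 1) by ring,
    show 2 * k + 1 + 1 = 2 * (k + 1) by ring, e₄, e] at e₂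
  linear_combination -e₂

theorem stmt_11 (S T : ℕ → ℝ) (hS : ProductRule S) (hT : ProductRule T)
    (hS0 : S 0 = 0) (hT0 : T 0 = 0) (hS1 : S 1 = 1) (hT1 : T 1 = 1)
    (h2 : S 2 = T 2) (h3 : S 3 = T 3) :
    ∀ n : ℕ, S n = T n := by
  have h4 : S 4 = T 4 := by
    have eS : S 4 = S 2 * S 2 + S 1 := hS.two_mul hS1 1
    have eT : T 4 = T 2 * T 2 + T 1 := hT.two_mul hT1 1
    rw [eS, eT, hS1, hT1, h2]
  intro n
  induction n using Nat.strong_induction_on with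
  | _ n ih =>
    obtain ⟨k, rfl | rfl⟩ := Nat.even_or_odd' n
    · rcases k with _ | k
      · exact hS0.trans hT0.symm
      · rw [hS.two_mul hS1, hT.two_mul hT1, ih (k + 1) (by omega), ih k (by omega), h2]
    · rcases k with _ | k
      · exact hS1.trans hT1.symm
      · rw [hS.two_mul_add_one hS1, hT.two_mul_add_one hT1, ih (k + 1 + 1) (by omega),
          ih (k + 1) (by omega), h2, h3, h4]
end

section
/- If a sequence T : ℕ → ℝ satisfies the product rule for triangular numbers with T(0) = 0 and T(1) = 1, and we set c = T(2) and d = T(3), then c² + 2c − 1 ≠ 0 and d = (3c³ + c)/(c² + 2c − 1). -/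
theorem ProductRule.two_three_relation {T : ℕ → ℝ} (h : ProductRule T) (h1 : T 1 = 1) :
    T 3 * (T 2 ^ 2 + 2 * T 2 - 1) = 3 * T 2 ^ 3 + T 2 := by
  have h4 := h 2 2 (by norm_num) (by norm_num)
  have h6 := h 2 3 (by norm_num) (by norm_num)
  have h8 := h 2 4 (by norm_num) (by norm_num)
  have h9 := h 3 3 (by norm_num) (by norm_num)
  have h12 := h 3 4 (by norm_num) (by norm_num)
  have h12' := h 2 6 (by norm_num) (by norm_num)
  have h18 := h 2 9 (by norm_num) (by norm_num)
  have h18' := h 3 6 (by norm_num) (by norm_num)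
  norm_num [h1] at h4 h6 h8 h9 h12 h12' h18 h18'
  have h5 : T 5 = T 3 * (T 2 + 1) - T 2 ^ 2 := by
    rw [h12, h4, h6] at h12'
    linear_combination -h12'
  rw [h18, h9, h8, h4, h6, h5] at h18'
  linear_combination -h18'

theorem stmt_13 (T : ℕ → ℝ) (h : ProductRule T) (h0 : T 0 = 0) (h1 : T 1 = 1)
    (c d : ℝ) (hc : c = T 2) (hd : d = T 3) :
    c ^ 2 + 2 * c - 1 ≠ 0 ∧ d = (3 * c ^ 3 + c) / (c ^ 2 + 2 * c - 1) := by
  have key := h.two_three_relation h1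
  rw [← hc, ← hd] at key
  have hne : c ^ 2 + 2 * c - 1 ≠ 0 := by
    intro hz
    rw [hz, mul_zero] at key
    have hc0 : c = 0 := by
      have hmul : c * (3 * c ^ 2 + 1) = 0 := by linear_combination -key
      exact (mul_eq_zero.mp hmul).resolve_right (by positivity)
    norm_num [hc0] at hz
  exact ⟨hne, (eq_div_iff hne).mpr key⟩
end

section
/- If a sequence T : ℕ → ℝ satisfies the product rule for triangular numbers with T(0) = 0 and T(1) = 1, then T(2) ∈ {0, 1, 3}. -/
theorem stmt_15 (T : ℕ → ℝ) (h : ProductRule T) (h0 : T 0 = 0) (h1 : T 1 = 1) :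
    T 2 ∈ ({0, 1, 3} : Set ℝ) := by
  have h22 := h 2 2 (by norm_num) (by norm_num)
  have h23 := h 2 3 (by norm_num) (by norm_num)
  have h24 := h 2 4 (by norm_num) (by norm_num)
  have h25 := h 2 5 (by norm_num) (by norm_num)
  have h26 := h 2 6 (by norm_num) (by norm_num)
  have h27 := h 2 7 (by norm_num) (by norm_num)
  have h28 := h 2 8 (by norm_num) (by norm_num)
  have h29 := h 2 9 (by norm_num) (by norm_num)
  have h2_15 := h 2 15 (by norm_num) (by norm_num)
  have h33 := h 3 3 (by norm_num) (by norm_num)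
  have h34 := h 3 4 (by norm_num) (by norm_num)
  have h35 := h 3 5 (by norm_num) (by norm_num)
  have h36 := h 3 6 (by norm_num) (by norm_num)
  have h3_10 := h 3 10 (by norm_num) (by norm_num)
  have h44 := h 4 4 (by norm_num) (by norm_num)
  norm_num [h1] at h22 h23 h24 h25 h26 h27 h28 h29 h2_15 h33 h34 h35 h36 h3_10 h44
  generalize T 2 = a at *
  generalize T 3 = b at *
  have h5 : T 5 = b + a * b - a ^ 2 := by
    rw [h26, h23, h22] at h34
    linear_combination h34
  have h7 : T 7 = a ^ 2 + 1 + b ^ 2 - a * b := by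
    rw [h28, h24, h22] at h44
    linear_combination h44
  have h18 : b * (a ^ 2 + 2 * a - 1) = 3 * a ^ 3 + a := by
    rw [h29, h33, h24, h23, h22, h5] at h36
    linear_combination -h36
  have h30 : b * (2 * a ^ 2 - a + 1) = a * (a ^ 3 + a + 2) := by
    rw [h2_15, h35, h27, h25, h33, h23, h22, h7, h5] at h3_10
    linear_combination -h3_10
  have key : a * (a - 3) * (a - 1) ^ 2 * (a ^ 2 + a + 1) = 0 := by
    linear_combination (2 * a ^ 2 - a + 1) * h18 - (a ^ 2 + 2 * a - 1) * h30
  have hpos : a ^ 2 + a + 1 ≠ 0 := by nlinarith [sq_nonneg (2 * a + 1)]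
  have hroots : (a = 0 ∨ a - 3 = 0) ∨ a - 1 = 0 := by simpa [hpos] using key
  simp only [Set.mem_insert_iff, Set.mem_singleton_iff]
  grind
end

section
/- If a sequence T : ℕ → ℝ satisfies the product rule for triangular numbers and T(0) ≠ 0, then T(1) ≠ 1 and T(n)·(1 − T(1)) = T(0)·T(n−1) for all n ≥ 1; consequently T(n) = T(0)·(T(1)/T(0))ⁿ for all n ≥ 0. -/
theorem ProductRule.mul_one_sub {T : ℕ → ℝ} (h : ProductRule T) (n : ℕ) :
    T (n + 1) * (1 - T 1) = T 0 * T n := by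
  have h1 := h 1 (n + 1) le_rfl (Nat.le_add_left 1 n)
  simp only [one_mul, Nat.sub_self, Nat.add_sub_cancel] at h1
  linear_combination h1

theorem ProductRule.apply_one_ne_one {T : ℕ → ℝ} (h : ProductRule T) (h0 : T 0 ≠ 0) :
    T 1 ≠ 1 := by
  intro h1
  have := h.mul_one_sub 0
  simp_all

theorem stmt_19 (T : ℕ → ℝ) (h : ProductRule T) (h0 : T 0 ≠ 0) :
    T 1 ≠ 1 ∧
    (∀ n : ℕ, 1 ≤ n → T n * (1 - T 1) = T 0 * T (n - 1)) ∧
    (∀ n : ℕ, T n = T 0 * (T 1 / T 0) ^ n) := by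
  have h1 := h.apply_one_ne_one h0
  refine ⟨h1, fun n hn => ?_, fun n => ?_⟩
  · obtain ⟨k, rfl⟩ := Nat.exists_eq_add_of_le' hn
    exact h.mul_one_sub k
  · induction n with
    | zero => simp
    | succ k ih =>
      rw [pow_succ, ← mul_assoc, ← ih]
      apply mul_right_cancel₀ (sub_ne_zero.mpr h1.symm)
      rw [h.mul_one_sub k]
      have h2 := h.mul_one_sub 0
      rw [zero_add] at h2
      field_simp
      linear_combination -T k * h2
end
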